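/- arXiv:2004.08657 — 2 statements merged into one kernel-verified Lean document; each statement's English description precedes it below -/
import Mathlib

section
/- Let {ξ_k}_{k≥0} be a sequence of positive real numbers. Suppose there exist an initial index k0 > 0 and real numbers A > 0 and α > β > 0 such that for every integer k ≥ 0, ξ_{k+1} ≤ exp(−α/(k0+k+1))·ξ_k + A/(k0+k+1)^{β+1}. Then for every integer K ≥ 1, ξ_K ≤ exp(−α·∑_{i=1}^K 1/(k0+i))·ξ_0 + (1/(α−β))·e^{α/(k0+1)}·A/(k0+K)^β + e^{α/(k0+1)}·A/(k0+K)^{β+1}, and consequently ξ_K ≤ ((k0+1)/(k0+K))^α·ξ_0 + (1/(α−β))·e^{α/(k0+1)}·A/(k0+K)^β + e^{α/(k0+1)}·A/(k0+K)^{β+1}. -/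
open Finset

lemma rpow_add_mul_rpow_sub_one_le_rpow_add_one {x γ : ℝ} (hx : 0 < x) (hγ : 1 ≤ γ) :
    x ^ γ + γ * x ^ (γ - 1) ≤ (x + 1) ^ γ := by
  have hinv : 0 < 1 / x := by positivity
  have hbern := one_add_mul_self_le_rpow_one_add (s := 1 / x) (by linarith) hγ
  have hfactor : (x + 1) ^ γ = x ^ γ * (1 + 1 / x) ^ γ := by
    rw [← Real.mul_rpow hx.le (by linarith)]
    congr 1
    field_simp
  calc x ^ γ + γ * x ^ (γ - 1) = x ^ γ * (1 + γ * (1 / x)) := by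
        rw [Real.rpow_sub_one hx.ne']; ring
    _ ≤ (x + 1) ^ γ := by rw [hfactor]; gcongr

lemma rpow_sub_one_add_mul_rpow_le {x γ : ℝ} (hx : 1 ≤ x) (hγ₀ : 0 ≤ γ) (hγ : γ ≤ 1) :
    (x - 1) ^ γ + γ * x ^ (γ - 1) ≤ x ^ γ := by
  have hx₀ : 0 < x := by linarith
  have hinv : 1 / x ≤ 1 := (div_le_one hx₀).2 hx
  have hbern := rpow_one_add_le_one_add_mul_self (s := -(1 / x)) (by linarith) hγ₀ hγ
  have hfactor : (x - 1) ^ γ = x ^ γ * (1 + -(1 / x)) ^ γ := by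
    rw [← Real.mul_rpow hx₀.le (by linarith)]
    congr 1
    field_simp
    ring
  calc (x - 1) ^ γ + γ * x ^ (γ - 1)
      ≤ x ^ γ * (1 + γ * -(1 / x)) + γ * x ^ (γ - 1) := by rw [hfactor]; gcongr
    _ = x ^ γ := by rw [Real.rpow_sub_one hx₀.ne']; ring

lemma sum_range_rpow_sub_one_le {a γ : ℝ} (ha : 0 ≤ a) (hγ : 0 < γ) (n : ℕ) :
    ∑ j ∈ range n, (a + j + 1) ^ (γ - 1) ≤ (a + n + 1) ^ γ / γ := by
  rw [le_div_iff₀ hγ]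
  rcases le_total 1 γ with h | h
  · induction n with
    | zero => simp; positivity
    | succ n ih =>
      have := rpow_add_mul_rpow_sub_one_le_rpow_add_one
        (show 0 < a + n + 1 by positivity) h
      rw [sum_range_succ]
      push_cast
      rw [← add_assoc a (n : ℝ) 1]
      linarith
  · have hsum : (∑ j ∈ range n, (a + j + 1) ^ (γ - 1)) * γ ≤ (a + n) ^ γ := by
      induction n with
      | zero => simp; positivity
      | succ n ih =>
        have hn : (0 : ℝ) ≤ n := n.cast_nonneg
        have := rpow_sub_one_add_mul_rpow_le (show 1 ≤ a + n + 1 by linarith) hγ.le h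
        rw [add_sub_cancel_right] at this
        rw [sum_range_succ]
        push_cast
        rw [← add_assoc a (n : ℝ) 1]
        linarith
    exact hsum.trans (Real.rpow_le_rpow (by positivity) (by linarith) hγ.le)

/-- One step of the comparison between the harmonic sum and the logarithm. -/
lemma exp_neg_div_le_div_rpow {x α : ℝ} (hx : 0 < x) (hα : 0 ≤ α) :
    Real.exp (-(α / x)) ≤ (x / (x + 1)) ^ α := by
  have hlog : Real.log ((x + 1) / x) ≤ 1 / x := by
    have := Real.log_le_sub_one_of_pos (show 0 < (x + 1) / x by positivity)
    have heq : (x + 1) / x - 1 = 1 / x := by field_simp; ring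
    linarith
  rw [Real.rpow_def_of_pos (by positivity), Real.exp_le_exp, ← inv_div (x + 1) x, Real.log_inv]
  have := mul_le_mul_of_nonneg_right hlog hα
  have heq : 1 / x * α = α / x := by ring
  linarith

lemma exp_neg_mul_sum_le_div_rpow {a α : ℝ} (ha : 0 ≤ a) (hα : 0 ≤ α) (n : ℕ) :
    Real.exp (-(α * ∑ i ∈ Icc 1 n, 1 / (a + i))) ≤ ((a + 1) / (a + n + 1)) ^ α := by
  induction n with
  | zero => simp [div_self (show a + 1 ≠ 0 by positivity)]
  | succ n ih =>
    have hstep := exp_neg_div_le_div_rpow (show 0 < a + n + 1 by positivity) hα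
    rw [sum_Icc_succ_top (by lia)]
    push_cast
    rw [← add_assoc a (n : ℝ) 1]
    calc Real.exp (-(α * (∑ i ∈ Icc 1 n, 1 / (a + i) + 1 / (a + n + 1))))
        = Real.exp (-(α * ∑ i ∈ Icc 1 n, 1 / (a + i))) * Real.exp (-(α / (a + n + 1))) := by
          rw [← Real.exp_add]; ring_nf
      _ ≤ ((a + 1) / (a + n + 1)) ^ α * ((a + n + 1) / (a + n + 1 + 1)) ^ α := by gcongr
      _ = ((a + 1) / (a + n + 1 + 1)) ^ α := by
          rw [← Real.mul_rpow (by positivity) (by positivity),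
            div_mul_div_cancel₀ (by positivity)]

lemma chung_recursion_le_sum {ξ : ℕ → ℝ} {a A α β : ℝ} (ha : 0 ≤ a) (hA : 0 ≤ A) (hα : 0 ≤ α)
    (hrec : ∀ k : ℕ,
      ξ (k + 1) ≤ Real.exp (-(α / (a + k + 1))) * ξ k + A / (a + k + 1) ^ (β + 1)) (n : ℕ) :
    ξ n ≤ Real.exp (-(α * ∑ i ∈ Icc 1 n, 1 / (a + i))) * ξ 0
      + Real.exp (α / (a + 1)) * A / (a + n + 1) ^ α
        * ∑ j ∈ range n, (a + j + 1) ^ (α - β - 1) := by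
  induction n with
  | zero => simp
  | succ n ih =>
    have hs : 0 < a + n + 1 := by positivity
    set s := a + n + 1 with hs_def
    set T := ∑ j ∈ range n, (a + j + 1) ^ (α - β - 1) with hT
    have hT₀ : 0 ≤ T := sum_nonneg fun j _ => by positivity
    have hstep := exp_neg_div_le_div_rpow hs hα
    have hold : Real.exp (-(α / s)) * (Real.exp (α / (a + 1)) * A / s ^ α * T)
        ≤ Real.exp (α / (a + 1)) * A / (s + 1) ^ α * T := by
      calc _ ≤ (s / (s + 1)) ^ α * (Real.exp (α / (a + 1)) * A / s ^ α * T) := by gcongr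
        _ = _ := by
          rw [Real.div_rpow hs.le (by positivity)]
          have : s ^ α ≠ 0 := by positivity
          field_simp
    have hnew : A / s ^ (β + 1)
        ≤ Real.exp (α / (a + 1)) * A / (s + 1) ^ α * s ^ (α - β - 1) := by
      have hexp : Real.exp (-(α / (a + 1))) ≤ Real.exp (-(α / s)) := by
        rw [Real.exp_le_exp, neg_le_neg_iff]
        have : (0 : ℝ) ≤ n := n.cast_nonneg
        gcongr
        linarith
      have hone : 1 ≤ Real.exp (α / (a + 1)) * (s / (s + 1)) ^ α := by
        calc 1 = Real.exp (α / (a + 1)) * Real.exp (-(α / (a + 1))) := by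
              rw [← Real.exp_add]; simp
          _ ≤ _ := by gcongr; exact hexp.trans hstep
      calc A / s ^ (β + 1) = 1 * (A / s ^ (β + 1)) := (one_mul _).symm
        _ ≤ Real.exp (α / (a + 1)) * (s / (s + 1)) ^ α * (A / s ^ (β + 1)) := by gcongr
        _ = _ := by
          rw [Real.div_rpow hs.le (by positivity), sub_sub, Real.rpow_sub hs]
          ring
    have hsplit : Real.exp (-(α * (∑ i ∈ Icc 1 n, 1 / (a + i) + 1 / s)))
        = Real.exp (-(α / s)) * Real.exp (-(α * ∑ i ∈ Icc 1 n, 1 / (a + i))) := by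
      rw [← Real.exp_add]; ring_nf
    rw [sum_Icc_succ_top (by lia), sum_range_succ]
    push_cast
    rw [← add_assoc a (n : ℝ) 1, ← hs_def, ← hT, hsplit]
    have := mul_le_mul_of_nonneg_left ih (Real.exp_pos (-(α / s))).le
    linarith [hrec n]

/-- **Non-asymptotic Chung's lemma.** -/
theorem chung_lemma (ξ : ℕ → ℝ) (hξ : ∀ k, 0 < ξ k)
    (k0 A α β : ℝ) (hk0 : 0 < k0) (hA : 0 < A) (hβ : 0 < β) (hβα : β < α)
    (hrec : ∀ k : ℕ,
      ξ (k + 1) ≤ Real.exp (-(α / (k0 + k + 1))) * ξ k + A / (k0 + k + 1) ^ (β + 1)) :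
    ∀ K : ℕ, 1 ≤ K →
      ξ K ≤ Real.exp (-(α * ∑ i ∈ Finset.Icc 1 K, 1 / (k0 + i))) * ξ 0
          + (1 / (α - β)) * Real.exp (α / (k0 + 1)) * A / (k0 + K) ^ β
          + Real.exp (α / (k0 + 1)) * A / (k0 + K) ^ (β + 1)
      ∧ ξ K ≤ ((k0 + 1) / (k0 + K)) ^ α * ξ 0
          + (1 / (α - β)) * Real.exp (α / (k0 + 1)) * A / (k0 + K) ^ β
          + Real.exp (α / (k0 + 1)) * A / (k0 + K) ^ (β + 1) := by
  intro K hK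
  have hα : 0 ≤ α := (hβ.trans hβα).le
  have hγ : 0 < α - β := sub_pos.2 hβα
  have hs : 0 < k0 + K := by positivity
  have hs_le : k0 + K ≤ k0 + K + 1 := by linarith
  have hsum : ∑ j ∈ range K, (k0 + j + 1) ^ (α - β - 1)
      ≤ (k0 + K) ^ (α - β) / (α - β) + (k0 + K) ^ (α - β - 1) := by
    obtain ⟨n, rfl⟩ := Nat.exists_eq_add_of_le' hK
    rw [sum_range_succ]
    push_cast
    rw [← add_assoc k0 (n : ℝ) 1]
    gcongr
    exact sum_range_rpow_sub_one_le hk0.le hγ n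
  have htail : Real.exp (α / (k0 + 1)) * A / (k0 + K + 1) ^ α
        * ∑ j ∈ range K, (k0 + j + 1) ^ (α - β - 1)
      ≤ (1 / (α - β)) * Real.exp (α / (k0 + 1)) * A / (k0 + K) ^ β
        + Real.exp (α / (k0 + 1)) * A / (k0 + K) ^ (β + 1) := by
    calc _ ≤ Real.exp (α / (k0 + 1)) * A / (k0 + K) ^ α
          * ((k0 + K) ^ (α - β) / (α - β) + (k0 + K) ^ (α - β - 1)) := by
          gcongr _ / ?_ ^ α * ?_
      _ = _ := by
          have : (k0 + K) ^ α ≠ 0 := by positivity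
          rw [sub_sub, Real.rpow_sub hs, Real.rpow_sub hs]
          field_simp
  have hmain := chung_recursion_le_sum hk0.le hA.le hα hrec K
  have hexp : Real.exp (-(α * ∑ i ∈ Icc 1 K, 1 / (k0 + i))) * ξ 0
      ≤ ((k0 + 1) / (k0 + K)) ^ α * ξ 0 := by
    gcongr
    · exact (hξ 0).le
    · refine (exp_neg_mul_sum_le_div_rpow hk0.le hα K).trans ?_
      gcongr ((k0 + 1) / ?_) ^ α
  constructor <;> linarith
end

section
/- Let n > 0 be an integer and {ξ_k}_{k≥0} a sequence of positive real numbers. Suppose there exist an initial index k0 > 0 and real numbers A_1, A_2 > 0, α > β > 0 and ε > 0 such that: (i) ξ_1 ≤ exp(−α·∑_{i=1}^n 1/(k0+i))·ξ_0 + A_1, and (ii) for every integer k ≥ 1, ξ_{k+1} ≤ exp(−α·∑_{i=1}^n 1/(k0+nk+i) + ε/k²)·ξ_k + A_2/(k0+n(k+1))^{β+1}. Then for every integer K ≥ 1, with c := e^{επ²/6}, ξ_K ≤ c(k0+1)^α/(k0+nK)^α·ξ_0 + c(k0+n+1)^α·A_1/(k0+nK)^α + (c/(α−β))·e^{α/(k0+n+1)}·A_2/(n(k0+nK)^β)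 + c·e^{α/(k0+n+1)}·A_2/(k0+nK)^{β+1}. -/
open Finset

/-- Comparison of a shifted harmonic sum with the logarithm, in exponential form. -/
lemma exp_neg_mul_sum_one_div_le (n : ℕ) {a α : ℝ} (ha : 0 < a) (hα : 0 ≤ α) :
    Real.exp (-(α * ∑ i ∈ Finset.Icc 1 n, 1 / (a + i))) ≤ (a + 1) ^ α / (a + n + 1) ^ α := by
  have hlog : Real.log (a + n + 1) - Real.log (a + 1) ≤ ∑ i ∈ Finset.Icc 1 n, 1 / (a + i) := by
    induction n with
    | zero => simp
    | succ m ih =>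
      rw [Finset.sum_Icc_succ_top (by omega)]
      push_cast
      have hm : 0 < a + m + 1 := by positivity
      have hm' : 0 < a + (m + 1) + 1 := by positivity
      have h := Real.log_le_sub_one_of_pos (div_pos hm' hm)
      rw [Real.log_div hm'.ne' hm.ne'] at h
      have heq : (a + (m + 1) + 1) / (a + m + 1) - 1 = 1 / (a + (m + 1)) := by
        rw [← add_assoc a]
        field_simp
        ring
      linarith
  rw [Real.rpow_def_of_pos (by positivity), Real.rpow_def_of_pos (by positivity), ← Real.exp_sub]
  apply Real.exp_le_exp.2
  nlinarith

lemma mul_rpow_sub_one_le_rpow_add_sub {x d γ : ℝ} (hx : 0 < x) (hd : 0 < d) (hγ : 1 ≤ γ) :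
    d * γ * x ^ (γ - 1) ≤ (x + d) ^ γ - x ^ γ := by
  have h := one_add_mul_self_le_rpow_one_add (s := d / x) (by linarith [div_pos hd hx]) hγ
  have hsplit : (x + d) ^ γ = x ^ γ * (1 + d / x) ^ γ := by
    rw [← Real.mul_rpow hx.le (by positivity)]
    congr 1
    field_simp
  have hmul := mul_le_mul_of_nonneg_left h (Real.rpow_nonneg hx.le γ)
  have heq : d * γ * x ^ (γ - 1) = x ^ γ * (γ * (d / x)) := by
    rw [Real.rpow_sub_one hx.ne']
    ring
  rw [hsplit, heq]
  linarith

lemma mul_rpow_add_sub_one_le_rpow_add_sub {x d γ : ℝ} (hx : 0 < x) (hd : 0 < d) (hγ : 0 ≤ γ)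
    (hγ' : γ ≤ 1) : d * γ * (x + d) ^ (γ - 1) ≤ (x + d) ^ γ - x ^ γ := by
  have hxd : 0 < x + d := by positivity
  have hle : d / (x + d) ≤ 1 := (div_le_one hxd).2 (by linarith)
  have h := rpow_one_add_le_one_add_mul_self (s := -(d / (x + d))) (by linarith) hγ hγ'
  have hsplit : x ^ γ = (x + d) ^ γ * (1 + -(d / (x + d))) ^ γ := by
    rw [← Real.mul_rpow hxd.le (by linarith)]
    congr 1
    field_simp
    ring
  have hmul := mul_le_mul_of_nonneg_left h (Real.rpow_nonneg hxd.le γ)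
  have heq : d * γ * (x + d) ^ (γ - 1) = (x + d) ^ γ * (γ * (d / (x + d))) := by
    rw [Real.rpow_sub_one hxd.ne']
    ring
  rw [heq]
  linarith

/-- Integral-type bound for a sum of powers along an arithmetic progression. -/
lemma sum_rpow_sub_one_le {a d γ : ℝ} (ha : 0 < a) (hd : 0 < d) (hγ : 0 < γ) {K : ℕ}
    (hK : 1 ≤ K) :
    ∑ j ∈ Finset.Ico 1 K, (a + d * (j + 1 : ℕ)) ^ (γ - 1) ≤
      (a + d * K) ^ γ / (d * γ) + (a + d * K) ^ (γ - 1) := by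
  have hdγ : 0 < d * γ := by positivity
  have hshift (k : ℕ) : a + d * (k + 1 : ℕ) = a + d * k + d := by push_cast; ring
  have hpos (k : ℕ) : 0 < a + d * k := by positivity
  rcases le_total 1 γ with h | h
  · induction K, hK using Nat.le_induction with
    | base => simp only [Finset.Ico_self, Finset.sum_empty]; positivity
    | succ k hk ih =>
      rw [Finset.sum_Ico_succ_top hk, hshift]
      have hstep := mul_rpow_sub_one_le_rpow_add_sub (hpos k) hd h
      have hdiv : (a + d * k) ^ (γ - 1) ≤
          (a + d * k + d) ^ γ / (d * γ) - (a + d * k) ^ γ / (d * γ) := by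
        rw [← sub_div, le_div_iff₀ hdγ]
        linarith
      linarith
  · suffices hsum : ∑ j ∈ Finset.Ico 1 K, (a + d * (j + 1 : ℕ)) ^ (γ - 1) ≤
        (a + d * K) ^ γ / (d * γ) by
      linarith [Real.rpow_nonneg (hpos K).le (γ - 1)]
    induction K, hK using Nat.le_induction with
    | base => simp only [Finset.Ico_self, Finset.sum_empty]; positivity
    | succ k hk ih =>
      rw [Finset.sum_Ico_succ_top hk, hshift]
      have hstep := mul_rpow_add_sub_one_le_rpow_add_sub (hpos k) hd hγ.le h
      have hdiv : (a + d * k + d) ^ (γ - 1) ≤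
          (a + d * k + d) ^ γ / (d * γ) - (a + d * k) ^ γ / (d * γ) := by
        rw [← sub_div, le_div_iff₀ hdγ]
        linarith
      linarith

lemma rpow_add_one_div_rpow_le {x y α β : ℝ} (hy : 0 < y) (hyx : y ≤ x) (hα : 0 ≤ α) :
    (x + 1) ^ α / x ^ (β + 1) ≤ Real.exp (α / y) * x ^ (α - β - 1) := by
  have hx : 0 < x := hy.trans_le hyx
  have hpow : (x + 1) ^ α ≤ x ^ α * Real.exp (α / y) := by
    calc (x + 1) ^ α ≤ (x * Real.exp (1 / y)) ^ α := by
          apply Real.rpow_le_rpow (by positivity) _ hα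
          have h := Real.add_one_le_exp (1 / y)
          have hxy : 1 ≤ x * (1 / y) := by
            rw [mul_one_div, one_le_div hy]
            exact hyx
          nlinarith
      _ = x ^ α * Real.exp (α / y) := by
          rw [Real.mul_rpow hx.le (Real.exp_pos _).le, ← Real.exp_mul]
          congr 2
          ring
  rw [div_le_iff₀ (by positivity), mul_assoc, ← Real.rpow_add hx]
  ring_nf at hpow ⊢
  linarith

/-- The recursion of Chung's lemma, unrolled. -/
lemma chung_recursion_le (n : ℕ) (ξ : ℕ → ℝ) (hξ : ∀ k, 0 ≤ ξ k)
    {k0 A₁ A₂ α β ε : ℝ} (hk0 : 0 < k0) (hA₂ : 0 ≤ A₂) (hα : 0 ≤ α) (hε : 0 ≤ ε)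
    (h1 : ξ 1 ≤ Real.exp (-(α * ∑ i ∈ Finset.Icc 1 n, 1 / (k0 + i))) * ξ 0 + A₁)
    (hrec : ∀ k : ℕ, 1 ≤ k →
      ξ (k + 1) ≤ Real.exp (-(α * ∑ i ∈ Finset.Icc 1 n, 1 / (k0 + n * k + i)) + ε / k ^ 2) * ξ k
          + A₂ / (k0 + n * (k + 1)) ^ (β + 1)) {K : ℕ} (hK : 1 ≤ K) :
    ξ K ≤ Real.exp (ε * ∑ k ∈ Finset.range K, 1 / (k : ℝ) ^ 2) / (k0 + n * K + 1) ^ α *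
      ((k0 + 1) ^ α * ξ 0 + (k0 + n + 1) ^ α * A₁ + A₂ * ∑ j ∈ Finset.Ico 1 K,
        (k0 + n * (j + 1 : ℕ) + 1) ^ α / (k0 + n * (j + 1 : ℕ)) ^ (β + 1)) := by
  induction K, hK using Nat.le_induction with
  | base =>
    have h := mul_le_mul_of_nonneg_right (exp_neg_mul_sum_one_div_le n hk0 hα) (hξ 0)
    have hp : (k0 + n + 1) ^ α ≠ 0 := by positivity
    refine h1.trans ((add_le_add_left h _).trans_eq ?_)
    simp
    field_simp
  | succ k hk ih =>
    have hx : 0 < k0 + n * k := by positivity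
    have hfac := exp_neg_mul_sum_one_div_le n hx hα
    have hshift : k0 + n * (k + 1 : ℕ) = k0 + n * k + n := by push_cast; ring
    have hshift' : k0 + n * ((k : ℝ) + 1) = k0 + n * k + n := by ring
    have hr := hrec k hk
    rw [Real.exp_add, hshift'] at hr
    rw [Finset.sum_Ico_succ_top hk, Finset.sum_range_succ, mul_add ε, Real.exp_add, mul_one_div,
      hshift]
    set E := Real.exp (ε * ∑ k ∈ Finset.range k, 1 / (k : ℝ) ^ 2)
    set e := Real.exp (ε / (k : ℝ) ^ 2)
    set B := (k0 + 1) ^ α * ξ 0 + (k0 + n + 1) ^ α * A₁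
    set S := ∑ j ∈ Finset.Ico 1 k,
        (k0 + n * (j + 1 : ℕ) + 1) ^ α / (k0 + n * (j + 1 : ℕ)) ^ (β + 1)
    have hE : 1 ≤ E := Real.one_le_exp (by positivity)
    have he : 1 ≤ e := Real.one_le_exp (by positivity)
    have hEe : 1 ≤ E * e := one_le_mul_of_one_le_of_one_le hE he
    set P := (k0 + n * k + 1) ^ α
    have hP : 0 < P := by positivity
    set Q := (k0 + n * k + n + 1) ^ α
    have hQ : 0 < Q := by positivity
    set R := (k0 + n * k + n) ^ (β + 1)
    have hR : 0 < R := by positivity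
    calc ξ (k + 1) ≤ P / Q * e * ξ k + A₂ / R := by
          refine hr.trans (by gcongr; exact hξ k)
      _ ≤ P / Q * e * (E / P * (B + A₂ * S)) + E * e * (A₂ / R) := by
          gcongr
          exact le_mul_of_one_le_left (by positivity) hEe
      _ = E * e / Q * (B + A₂ * (S + Q / R)) := by
          field_simp
          ring

/-- **A two-parameter variant of Chung's lemma.** -/
theorem chung_variant (n : ℕ) (hn : 0 < n) (ξ : ℕ → ℝ) (hξ : ∀ k, 0 < ξ k)
    (k0 A₁ A₂ α β ε : ℝ) (hk0 : 0 < k0) (hA₁ : 0 < A₁) (hA₂ : 0 < A₂)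
    (hβ : 0 < β) (hβα : β < α) (hε : 0 < ε)
    (h1 : ξ 1 ≤ Real.exp (-(α * ∑ i ∈ Finset.Icc 1 n, 1 / (k0 + i))) * ξ 0 + A₁)
    (hrec : ∀ k : ℕ, 1 ≤ k →
      ξ (k + 1) ≤ Real.exp (-(α * ∑ i ∈ Finset.Icc 1 n, 1 / (k0 + n * k + i)) + ε / k ^ 2) * ξ k
          + A₂ / (k0 + n * (k + 1)) ^ (β + 1)) :
    ∀ K : ℕ, 1 ≤ K →
      ξ K ≤ Real.exp (ε * Real.pi ^ 2 / 6) * (k0 + 1) ^ α / (k0 + n * K) ^ α * ξ 0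
          + Real.exp (ε * Real.pi ^ 2 / 6) * (k0 + n + 1) ^ α * A₁ / (k0 + n * K) ^ α
          + (Real.exp (ε * Real.pi ^ 2 / 6) / (α - β)) * Real.exp (α / (k0 + n + 1)) * A₂
              / (n * (k0 + n * K) ^ β)
          + Real.exp (ε * Real.pi ^ 2 / 6) * Real.exp (α / (k0 + n + 1)) * A₂
              / (k0 + n * K) ^ (β + 1) := by
  intro K hK
  have hn' : (0 : ℝ) < n := by exact_mod_cast hn
  have hα : 0 < α := hβ.trans hβα
  have hγ : 0 < α - β := sub_pos.2 hβα
  have hx : 0 < k0 + n * K := by positivity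
  have hmain := chung_recursion_le n ξ (fun k => (hξ k).le) hk0 hA₂.le hα.le hε.le h1 hrec hK
  have hE : Real.exp (ε * ∑ k ∈ Finset.range K, 1 / (k : ℝ) ^ 2) ≤
      Real.exp (ε * Real.pi ^ 2 / 6) := by
    rw [mul_div_assoc]
    gcongr
    exact sum_le_hasSum _ (fun _ _ => by positivity) hasSum_zeta_two
  have hS : ∑ j ∈ Finset.Ico 1 K,
        (k0 + n * (j + 1 : ℕ) + 1) ^ α / (k0 + n * (j + 1 : ℕ)) ^ (β + 1) ≤
      Real.exp (α / (k0 + n + 1)) *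
        ((k0 + n * K) ^ (α - β) / (n * (α - β)) + (k0 + n * K) ^ (α - β - 1)) := by
    refine le_trans ?_
      (mul_le_mul_of_nonneg_left (sum_rpow_sub_one_le hk0 hn' hγ hK) (Real.exp_pos _).le)
    rw [Finset.mul_sum]
    refine Finset.sum_le_sum fun j hj => rpow_add_one_div_rpow_le (by positivity) ?_ hα.le
    have hj1 : (1 : ℝ) ≤ j := by exact_mod_cast (Finset.mem_Ico.1 hj).1
    have hn1 : (1 : ℝ) ≤ n := by exact_mod_cast hn
    push_cast
    nlinarith
  have hξ0 := (hξ 0).le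
  have hsplit : (k0 + n * K) ^ (α - β) = (k0 + n * K) ^ α / (k0 + n * K) ^ β :=
    Real.rpow_sub hx _ _
  have hsplit' : (k0 + n * K) ^ (α - β - 1) = (k0 + n * K) ^ α / (k0 + n * K) ^ (β + 1) := by
    rw [← Real.rpow_sub hx]
    congr 1
    ring
  rw [hsplit, hsplit'] at hS
  have hQ : (k0 + n * K) ^ α ≤ (k0 + n * K + 1) ^ α :=
    Real.rpow_le_rpow hx.le (by linarith) hα.le
  refine hmain.trans ((mul_le_mul (div_le_div₀ (Real.exp_pos _).le hE (by positivity) hQ)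
    (add_le_add_right (mul_le_mul_of_nonneg_left hS hA₂.le) _) (by positivity)
    (by positivity)).trans_eq ?_)
  have hp : (k0 + n * K) ^ α ≠ 0 := by positivity
  have hp' : (k0 + n * K) ^ β ≠ 0 := by positivity
  have hp'' : (k0 + n * K) ^ (β + 1) ≠ 0 := by positivity
  generalize (k0 + n * K) ^ α = X at *
  generalize (k0 + n * K) ^ β = Y at *
  generalize (k0 + n * K) ^ (β + 1) = Z at *
  field_simp
  ring
end
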